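/- A topological space X is spectral (homeomorphic to the Zariski spectrum of a commutative ring) if and only if X is sober, quasi-compact, and the quasi-compact open subsets of X form a basis closed under finite intersections. -/

import Mathlib

open Topology

noncomputable section

namespace Hochster

/-! ### Degenerations of a rational function field -/

section Degeneration

variable {σ : Type*}

/-- The field of rational functions over `ℚ` in the variables `σ`. -/
abbrev FunctionField (σ : Type*) : Type _ := FractionRing (MvPolynomial σ ℚ)

/-- The variable `i`, as a rational function. -/
def indeterminate (i : σ) : FunctionField σ :=
  algebraMap (MvPolynomial σ ℚ) (FunctionField σ) (MvPolynomial.X i)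

lemma indeterminate_ne_zero (i : σ) : indeterminate i ≠ 0 := by
  simp [indeterminate]

open scoped Classical in
/-- Multiply the variables in `W` by the parameter of a polynomial ring. -/
def scalePolynomial (W : Set σ) : MvPolynomial σ ℚ →ₐ[ℚ] Polynomial (FunctionField σ) :=
  MvPolynomial.aeval fun i =>
    if i ∈ W then Polynomial.X * Polynomial.C (indeterminate i) else Polynomial.C (indeterminate i)

lemma eval_one_scalePolynomial (W : Set σ) (p : MvPolynomial σ ℚ) :
    (scalePolynomial W p).eval 1 = algebraMap (MvPolynomial σ ℚ) (FunctionField σ) p := by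
  have h : ((Polynomial.aeval (1 : FunctionField σ)).restrictScalars ℚ).comp (scalePolynomial W) =
      IsScalarTower.toAlgHom ℚ (MvPolynomial σ ℚ) (FunctionField σ) := by
    apply MvPolynomial.algHom_ext
    intro i
    by_cases hi : i ∈ W <;> simp [scalePolynomial, hi, indeterminate]
  simpa [Polynomial.aeval_def, Polynomial.eval₂_eq_eval_map] using DFunLike.congr_fun h p

lemma scalePolynomial_injective (W : Set σ) : Function.Injective (scalePolynomial W) := by
  intro p q h
  apply IsFractionRing.injective (MvPolynomial σ ℚ) (FunctionField σ)
  rw [← eval_one_scalePolynomial W, h, eval_one_scalePolynomial]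

lemma natDegree_scalePolynomial_le (W : Set σ) (p : MvPolynomial σ ℚ) :
    (scalePolynomial W p).natDegree ≤ p.totalDegree := by
  classical
  have h := MvPolynomial.aeval_natDegree_le (n := 1)
    (MvPolynomial.map (algebraMap ℚ (FunctionField σ)) p) 
    (Finset.sup_mono (MvPolynomial.support_map_subset _ p))
    (fun i => if i ∈ W then Polynomial.X * Polynomial.C (indeterminate i)
      else Polynomial.C (indeterminate i)) (fun i => by
        split_ifs
        · exact Polynomial.natDegree_mul_C_le _ _ |>.trans (by simp)
        · simp)
  rw [MvPolynomial.aeval_map_algebraMap, mul_one] at h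
  exact h

/-- Polynomials as Laurent series. -/
def polynomialToLaurent (K : Type*) [Field K] : Polynomial K →+* LaurentSeries K :=
  (HahnSeries.ofPowerSeries ℤ K).comp Polynomial.coeToPowerSeries.ringHom

lemma polynomialToLaurent_injective (K : Type*) [Field K] :
    Function.Injective (polynomialToLaurent K) :=
  HahnSeries.ofPowerSeries_injective.comp (Polynomial.coe_injective K)

/-- The embedding of the function field in Laurent series over itself which multiplies the
variables in `W` by the parameter. -/
def degeneration (W : Set σ) : FunctionField σ →+* LaurentSeries (FunctionField σ) :=
  IsFractionRing.lift (A := MvPolynomial σ ℚ)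
    (g := (polynomialToLaurent (FunctionField σ)).comp (scalePolynomial W).toRingHom)
    ((polynomialToLaurent_injective _).comp (scalePolynomial_injective W))

lemma degeneration_algebraMap (W : Set σ) (p : MvPolynomial σ ℚ) :
    degeneration W (algebraMap _ _ p) =
      HahnSeries.ofPowerSeries ℤ _ (scalePolynomial W p : PowerSeries (FunctionField σ)) :=
  IsFractionRing.lift_algebraMap _ _

/-- A nonzero polynomial of degree at most `N` divides the `N`-th power of the variable
as a power series. -/
lemma polynomial_dvd_X_pow {K : Type*} [Field K] {p : Polynomial K} (hp : p ≠ 0) {N : ℕ}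
    (hN : p.natDegree ≤ N) : (p : PowerSeries K) ∣ PowerSeries.X ^ N := by
  obtain ⟨q, hq, hq0⟩ := Polynomial.exists_eq_pow_rootMultiplicity_mul_and_not_dvd p hp 0
  set m := p.rootMultiplicity 0
  have hm : m ≤ N := by
    have hdvd : Polynomial.X ^ m ∣ p := ⟨q, by simpa using hq⟩
    have := Polynomial.natDegree_le_of_dvd hdvd hp
    rw [Polynomial.natDegree_X_pow] at this
    omega
  have hunit : IsUnit (q : PowerSeries K) := by
    rw [PowerSeries.isUnit_iff_constantCoeff]
    rw [map_zero, sub_zero, Polynomial.X_dvd_iff] at hq0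
    simpa using hq0
  rw [hq]
  simp only [map_zero, sub_zero, Polynomial.coe_mul, Polynomial.coe_pow, Polynomial.coe_X]
  rw [hunit.mul_right_dvd]
  exact pow_dvd_pow _ hm

/-- The orders of vanishing of a nonzero rational function along all degenerations are bounded. -/
lemma exists_degeneration_mul_eq {a : FunctionField σ} (ha : a ≠ 0) :
    ∃ N : ℕ, ∀ M ≥ N, ∀ W : Set σ, ∃ r : PowerSeries (FunctionField σ),
      degeneration W a * HahnSeries.ofPowerSeries ℤ _ r =
        HahnSeries.ofPowerSeries ℤ _ (PowerSeries.X ^ M) := by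
  obtain ⟨p, q, hq, rfl⟩ := IsFractionRing.div_surjective (A := MvPolynomial σ ℚ) a
  have hp : p ≠ 0 := by rintro rfl; simp at ha
  refine ⟨p.totalDegree, fun M hM W => ?_⟩
  obtain ⟨s, hs⟩ := polynomial_dvd_X_pow
    ((map_ne_zero_iff _ (scalePolynomial_injective W)).2 hp)
    ((natDegree_scalePolynomial_le W p).trans hM)
  have hq' : degeneration W (algebraMap _ _ q) ≠ 0 := by
    simpa using nonZeroDivisors.ne_zero hq
  refine ⟨(scalePolynomial W q : PowerSeries (FunctionField σ)) * s, ?_⟩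
  rw [hs, map_mul, map_mul, map_div₀, ← degeneration_algebraMap, ← degeneration_algebraMap]
  field_simp

/-- The pairs consisting of a power series and its value at zero. -/
def valueGraph (K : Type*) [Field K] : Subring (LaurentSeries K × K) :=
  ((HahnSeries.ofPowerSeries ℤ K).prod PowerSeries.constantCoeff).range

lemma mem_valueGraph {K : Type*} [Field K] {e : LaurentSeries K} {c : K} :
    (e, c) ∈ valueGraph K ↔
      ∃ p : PowerSeries K, HahnSeries.ofPowerSeries ℤ K p = e ∧ p.constantCoeff = c := by
  simp [valueGraph, RingHom.mem_range]

/-- The pairs `(a, c)` such that the degeneration of `a` along `W` is regular with value `c`. -/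
def specializationGraph (W : Set σ) : Subring (FunctionField σ × FunctionField σ) :=
  (valueGraph (FunctionField σ)).comap ((degeneration W).prodMap (RingHom.id _))

lemma mem_specializationGraph {W : Set σ} {a c : FunctionField σ} :
    (a, c) ∈ specializationGraph W ↔ ∃ p : PowerSeries (FunctionField σ),
      HahnSeries.ofPowerSeries ℤ _ p = degeneration W a ∧ p.constantCoeff = c := by
  rw [← mem_valueGraph]
  rfl

lemma eq_zero_of_zero_mem_specializationGraph {W : Set σ} {c : FunctionField σ}
    (h : (0, c) ∈ specializationGraph W) : c = 0 := by
  obtain ⟨p, hp, rfl⟩ := mem_specializationGraph.1 h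
  rw [map_zero, map_eq_zero_iff _ HahnSeries.ofPowerSeries_injective] at hp
  simp [hp]

lemma inv_mem_specializationGraph {W : Set σ} {a c : FunctionField σ}
    (h : (a, c) ∈ specializationGraph W) (hc : c ≠ 0) : (a⁻¹, c⁻¹) ∈ specializationGraph W := by
  obtain ⟨p, hp, rfl⟩ := mem_specializationGraph.1 h
  refine mem_specializationGraph.2 ⟨p⁻¹, ?_, by simp⟩
  rw [map_inv₀, ← hp]
  apply eq_inv_of_mul_eq_one_left
  rw [← map_mul, PowerSeries.inv_mul_cancel _ hc, map_one]

lemma indeterminate_mem_specializationGraph_of_mem {W : Set σ} {i : σ} (hi : i ∈ W) :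
    (indeterminate i, 0) ∈ specializationGraph W :=
  mem_specializationGraph.2 ⟨_, (degeneration_algebraMap W _).symm, by
    simp [scalePolynomial, hi]⟩

lemma indeterminate_mem_specializationGraph_of_notMem {W : Set σ} {i : σ} (hi : i ∉ W) :
    (indeterminate i, indeterminate i) ∈ specializationGraph W :=
  mem_specializationGraph.2 ⟨_, (degeneration_algebraMap W _).symm, by
    simp [scalePolynomial, hi]⟩

/-- Large powers of a function vanishing at the special point are divisible by any nonzero
function, uniformly in the degeneration. -/
lemma exists_pow_div_mem_specializationGraph {b : FunctionField σ} (hb : b ≠ 0) :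
    ∃ N : ℕ, ∀ M ≥ N, ∀ (W : Set σ) (a : FunctionField σ), (a, 0) ∈ specializationGraph W →
      (a ^ (M + 1) / b, 0) ∈ specializationGraph W := by
  obtain ⟨N, hN⟩ := exists_degeneration_mul_eq hb
  refine ⟨N, fun M hM W a ha => ?_⟩
  obtain ⟨p, hp, hp0⟩ := mem_specializationGraph.1 ha
  obtain ⟨q, rfl⟩ := PowerSeries.X_dvd_iff.2 hp0
  obtain ⟨r, hr⟩ := hN M hM W
  refine mem_specializationGraph.2 ⟨PowerSeries.X * q ^ (M + 1) * r, ?_, by simp⟩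
  have hb' : degeneration W b ≠ 0 := by simpa using hb
  rw [map_div₀, map_pow, ← hp, eq_div_iff hb']
  calc _ = HahnSeries.ofPowerSeries ℤ _ (PowerSeries.X * q ^ (M + 1)) *
        (degeneration W b * HahnSeries.ofPowerSeries ℤ _ r) := by rw [map_mul]; ring
    _ = _ := by rw [hr, ← map_mul, ← map_pow]; congr 1; ring

end Degeneration

/-! ### The ring attached to a spectral space -/

section Ring

variable {X : Type*} [TopologicalSpace X]

/-- The functions on `X` with values in the rational functions in variables indexed by the subsets
of `X` which are locally constant in the constructible topology. -/
def locallyConstantRing (X : Type*) [TopologicalSpace X] :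
    Subring (X → FunctionField (Set X)) where
  carrier := {f | IsLocallyConstant (fun x : WithConstructibleTopology X => f x.ofTopology)}
  mul_mem' hf hg := hf.mul hg
  add_mem' hf hg := hf.add hg
  one_mem' := .const 1
  zero_mem' := .const 0
  neg_mem' hf := hf.neg

/-- The functions on `X` which are locally constant in the constructible topology and which, along
each specialization `x ⤳ y`, degenerate to their value at `y` when the variables of the sets
separating `x` from `y` go to zero. -/
def functionRing (X : Type*) [TopologicalSpace X] : Subring (X → FunctionField (Set X)) :=
  locallyConstantRing X ⊓ ⨅ p : {p : X × X // p.1 ⤳ p.2},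
    (specializationGraph {U | p.1.1 ∈ U ∧ p.1.2 ∉ U}).comap
      ((Pi.evalRingHom _ p.1.1).prod (Pi.evalRingHom _ p.1.2))

lemma mem_functionRing {f : X → FunctionField (Set X)} : f ∈ functionRing X ↔
    IsLocallyConstant (fun x : WithConstructibleTopology X => f x.ofTopology) ∧
      ∀ x y, x ⤳ y → (f x, f y) ∈ specializationGraph {U | x ∈ U ∧ y ∉ U} := by
  rw [functionRing, Subring.mem_inf, Subring.mem_iInf]
  exact and_congr Iff.rfl ⟨fun h x y hxy => h ⟨(x, y), hxy⟩, fun h p => h _ _ p.2⟩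

lemma isLocallyConstant (f : functionRing X) :
    IsLocallyConstant (fun x : WithConstructibleTopology X => f.1 x.ofTopology) :=
  (mem_functionRing.1 f.2).1

lemma specialization_mem (f : functionRing X) {x y : X} (h : x ⤳ y) :
    (f.1 x, f.1 y) ∈ specializationGraph {U | x ∈ U ∧ y ∉ U} :=
  (mem_functionRing.1 f.2).2 x y h

lemma ne_zero_of_specializes (f : functionRing X) {x y : X} (h : x ⤳ y) (hy : f.1 y ≠ 0) :
    f.1 x ≠ 0 := by
  intro hx
  have := specialization_mem f h
  rw [hx] at this
  exact hy (eq_zero_of_zero_mem_specializationGraph this)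

/-- The nonvanishing locus of a function in the ring is open and closed in the constructible
topology. -/
lemma isClopen_preimage_ne_zero (f : functionRing X) :
    IsClopen (WithTopology.ofTopology ⁻¹' {x | f.1 x ≠ 0} : Set (WithConstructibleTopology X)) :=
  ((isLocallyConstant f).isClopen_fiber 0).compl

/-- A compact open set is open and closed in the constructible topology. -/
lemma isClopen_preimage_ofTopology {U : Set X} (ho : IsOpen U) (hc : IsCompact U) :
    IsClopen (WithTopology.ofTopology ⁻¹' U : Set (WithConstructibleTopology X)) := by
  constructor
  · rw [← isOpen_compl_iff, WithConstructibleTopology.isOpen_iff]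
    exact IsCompact.isOpen_constructibleTopology_of_isClosed (s := Uᶜ) (by simpa using hc)
      ho.isClosed_compl
  · rw [WithConstructibleTopology.isOpen_iff]
    exact hc.isOpen_constructibleTopology_of_isOpen ho

open scoped Classical in
/-- The function which is the variable `U` on `U` and zero elsewhere. -/
def coordinate {U : Set X} (ho : IsOpen U) (hc : IsCompact U) : functionRing X :=
  ⟨fun x => if x ∈ U then indeterminate U else 0, by
    refine mem_functionRing.2 ⟨?_, ?_⟩
    · have hU := isClopen_preimage_ofTopology ho hc
      rw [IsLocallyConstant.iff_eventually_eq]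
      intro x
      by_cases hx : x.ofTopology ∈ U
      · filter_upwards [hU.2.mem_nhds hx] with y hy
        rw [if_pos hx, if_pos (Set.mem_preimage.1 hy)]
      · filter_upwards [hU.1.isOpen_compl.mem_nhds hx] with y hy
        rw [if_neg hx, if_neg (show y.ofTopology ∉ U from hy)]
    · intro x y h
      by_cases hy : y ∈ U
      · rw [if_pos hy, if_pos (h.mem_open ho hy)]
        exact indeterminate_mem_specializationGraph_of_notMem (by simp [hy])
      · rw [if_neg hy]
        split_ifs with hx
        · exact indeterminate_mem_specializationGraph_of_mem ⟨hx, hy⟩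
        · exact zero_mem _⟩

lemma coordinate_ne_zero_iff {U : Set X} (ho : IsOpen U) (hc : IsCompact U) {x : X} :
    (coordinate ho hc).1 x ≠ 0 ↔ x ∈ U := by
  simp [coordinate, indeterminate_ne_zero]

/-- The prime ideal of functions vanishing at a point. -/
def toPrimeSpectrum (x : X) : PrimeSpectrum (functionRing X) :=
  ⟨RingHom.ker ((Pi.evalRingHom _ x).comp (functionRing X).subtype), RingHom.ker_isPrime _⟩

lemma mem_toPrimeSpectrum {x : X} {f : functionRing X} :
    f ∈ (toPrimeSpectrum x).asIdeal ↔ f.1 x = 0 :=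
  Iff.rfl

section Spectral

variable [SpectralSpace X]

/-- The range of a function in the ring is finite. -/
lemma finite_range (f : functionRing X) : (Set.range f.1).Finite := by
  refine (isLocallyConstant f).range_finite.subset ?_
  rintro _ ⟨x, rfl⟩
  exact ⟨WithTopology.toTopology _ x, rfl⟩

/-- A set closed in the constructible topology and stable under specialization is closed. -/
lemma isClosed_of_stableUnderSpecialization {C : Set X}
    (hC : IsClosed (WithTopology.ofTopology ⁻¹' C : Set (WithConstructibleTopology X)))
    (hs : StableUnderSpecialization C) : IsClosed C := by
  rw [← closure_subset_iff_isClosed]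
  intro x hx
  let ι := {U : Set X // (IsOpen U ∧ IsCompact U) ∧ x ∈ U}
  have : Nonempty ι := ⟨⟨Set.univ, ⟨isOpen_univ, isCompact_univ⟩, trivial⟩⟩
  have hclosed (i : ι) : IsClosed
      (WithTopology.ofTopology ⁻¹' (C ∩ i.1) : Set (WithConstructibleTopology X)) :=
    hC.inter (isClopen_preimage_ofTopology i.2.1.1 i.2.1.2).1
  obtain ⟨z, hz⟩ := IsCompact.nonempty_iInter_of_directed_nonempty_isCompact_isClosed
    (fun i : ι => (WithTopology.ofTopology ⁻¹' (C ∩ i.1) : Set (WithConstructibleTopology X)))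
    (fun i j => ⟨⟨i.1 ∩ j.1, ⟨i.2.1.1.inter j.2.1.1, QuasiSeparatedSpace.inter_isCompact _ _
        i.2.1.1 i.2.1.2 j.2.1.1 j.2.1.2⟩, i.2.2, j.2.2⟩,
      fun y hy => ⟨hy.1, hy.2.1⟩, fun y hy => ⟨hy.1, hy.2.2⟩⟩)
    (fun i => by
      obtain ⟨y, hyU, hyC⟩ := mem_closure_iff.1 hx i.1 i.2.1.1 i.2.2
      exact ⟨WithTopology.toTopology _ y, hyC, hyU⟩)
    (fun i => (hclosed i).isCompact) hclosed
  rw [Set.mem_iInter] at hz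
  have hzC : z.ofTopology ∈ C := (hz (Classical.arbitrary ι)).1
  refine hs ?_ hzC
  rw [specializes_iff_forall_open]
  intro V hV hxV
  obtain ⟨U, hU, hxU, hUV⟩ :=
    PrespectralSpace.isTopologicalBasis.exists_subset_of_mem_open hxV hV
  exact hUV (hz ⟨U, hU, hxU⟩).2

/-- The nonvanishing locus of a function in the ring is open. -/
lemma isOpen_ne_zero (f : functionRing X) : IsOpen {x | f.1 x ≠ 0} := by
  rw [← isClosed_compl_iff]
  apply isClosed_of_stableUnderSpecialization
  · exact (isClopen_preimage_ne_zero f).compl.1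
  · intro x y h hx hy
    exact hx (ne_zero_of_specializes f h hy)

/-- If `f` vanishes wherever `g` does, then `g` divides a power of `f`. -/
lemma exists_dvd_pow {f g : functionRing X} (h : ∀ x, f.1 x ≠ 0 → g.1 x ≠ 0) :
    ∃ N : ℕ, g ∣ f ^ N := by
  have hbound (b : FunctionField (Set X)) : ∃ N : ℕ, b ≠ 0 → ∀ M ≥ N, ∀ (W : Set (Set X)) a,
      (a, 0) ∈ specializationGraph W → (a ^ (M + 1) / b, 0) ∈ specializationGraph W := by
    by_cases hb : b = 0
    · exact ⟨0, fun h => absurd hb h⟩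
    · obtain ⟨N, hN⟩ := exists_pow_div_mem_specializationGraph hb
      exact ⟨N, fun _ => hN⟩
  choose N hN using hbound
  obtain ⟨M, hM⟩ := ((finite_range g).image N).bddAbove
  have hM (x : X) : N (g.1 x) ≤ M := hM ⟨_, ⟨x, rfl⟩, rfl⟩
  have hq : (fun x => f.1 x ^ (M + 1) / g.1 x) ∈ functionRing X := by
    refine mem_functionRing.2 ⟨((isLocallyConstant f).comp (· ^ (M + 1))).div
      (isLocallyConstant g), fun x y hxy => ?_⟩
    by_cases hy : f.1 y = 0
    · have hfx := specialization_mem f hxy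
      simp only [hy, ne_eq, Nat.add_eq_zero_iff, one_ne_zero, and_false, not_false_eq_true,
        zero_pow, zero_div] at hfx ⊢
      by_cases hx : g.1 x = 0
      · rw [hx, div_zero]
        exact zero_mem _
      · exact hN _ hx M (hM x) _ _ hfx
    · rw [div_eq_mul_inv, div_eq_mul_inv, ← Prod.mk_mul_mk, ← Prod.pow_mk]
      exact mul_mem (pow_mem (specialization_mem f hxy) (M + 1))
        (inv_mem_specializationGraph (specialization_mem g hxy) (h y hy))
  refine ⟨M + 1, ⟨_, hq⟩, Subtype.ext (funext fun x => ?_)⟩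
  change f.1 x ^ (M + 1) = g.1 x * (f.1 x ^ (M + 1) / g.1 x)
  by_cases hx : g.1 x = 0
  · have : f.1 x = 0 := by_contra fun hf => h x hf hx
    simp [this]
  · rw [mul_div_cancel₀ _ hx]

/-- Some combination of `f` and `g` vanishes only where both do. -/
lemma exists_add_natCast_mul_ne_zero (f g : functionRing X) :
    ∃ n : ℕ, ∀ x, f.1 x ≠ 0 ∨ g.1 x ≠ 0 → (f + n * g).1 x ≠ 0 := by
  have hfin : (((fun p : FunctionField (Set X) × FunctionField (Set X) => -p.1 / p.2) ''
      (Set.range f.1 ×ˢ Set.range g.1)) ∪ {0}).Finite :=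
    (((finite_range f).prod (finite_range g)).image _).union (Set.finite_singleton 0)
  obtain ⟨n, hn⟩ :=
    (hfin.preimage (f := fun n : ℕ => (n : FunctionField (Set X)))
      Nat.cast_injective.injOn).exists_notMem
  refine ⟨n, fun x hx h => hn ?_⟩
  change f.1 x + n * g.1 x = 0 at h
  by_cases hg : g.1 x = 0
  · simp_all
  · refine Or.inl ⟨(f.1 x, g.1 x), ⟨⟨x, rfl⟩, ⟨x, rfl⟩⟩, ?_⟩
    change -f.1 x / g.1 x = n
    rw [div_eq_iff hg]
    linear_combination -h

lemma toPrimeSpectrum_surjective : Function.Surjective (toPrimeSpectrum (X := X)) := by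
  intro p
  by_contra! hp
  let ι := {q : functionRing X × functionRing X // q.1 ∈ p.asIdeal ∧ q.2 ∉ p.asIdeal}
  have : Nonempty ι := ⟨⟨(0, 1), zero_mem _, p.asIdeal.one_notMem⟩⟩
  obtain ⟨i, hi⟩ := isCompact_univ.elim_directed_cover
    (fun i : ι => (WithTopology.ofTopology ⁻¹' {x | i.1.1.1 x ≠ 0} ∪
      (WithTopology.ofTopology ⁻¹' {x | i.1.2.1 x ≠ 0})ᶜ : Set (WithConstructibleTopology X)))
    (fun i => (isClopen_preimage_ne_zero i.1.1).2.union
      (isClopen_preimage_ne_zero i.1.2).compl.2)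
    (fun z _ => by
      rw [Set.mem_iUnion]
      by_contra! hz
      apply hp z.ofTopology
      ext f
      rw [mem_toPrimeSpectrum]
      constructor
      · intro hf
        by_contra hfp
        exact hz ⟨(0, f), zero_mem _, hfp⟩ (Or.inr fun h => h hf)
      · intro hfp
        by_contra hf
        exact hz ⟨(f, 1), hfp, p.asIdeal.one_notMem⟩ (Or.inl hf))
    (fun i j => by
      obtain ⟨n, hn⟩ := exists_add_natCast_mul_ne_zero i.1.1 j.1.1
      refine ⟨⟨(i.1.1 + n * j.1.1, i.1.2 * j.1.2),
        add_mem i.2.1 (Ideal.mul_mem_left _ _ j.2.1),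
        fun h => (p.isPrime.mem_or_mem h).elim i.2.2 j.2.2⟩, ?_, ?_⟩
      · exact Set.union_subset_union (fun z hz => hn _ (Or.inl hz))
          (Set.compl_subset_compl.2 fun z hz => left_ne_zero_of_mul hz)
      · exact Set.union_subset_union (fun z hz => hn _ (Or.inr hz))
          (Set.compl_subset_compl.2 fun z hz => right_ne_zero_of_mul hz))
  obtain ⟨N, hN⟩ := exists_dvd_pow (f := i.1.2) (g := i.1.1) fun x hx =>
    (hi (Set.mem_univ (WithTopology.toTopology _ x))).resolve_right fun h => h hx
  exact i.2.2 (p.isPrime.mem_of_pow_mem N (p.asIdeal.mem_of_dvd hN i.2.1))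

lemma isInducing_toPrimeSpectrum : IsInducing (toPrimeSpectrum (X := X)) := by
  constructor
  apply le_antisymm
  · rw [← continuous_iff_le_induced, PrimeSpectrum.isTopologicalBasis_basic_opens.continuous_iff]
    rintro _ ⟨f, rfl⟩
    exact isOpen_ne_zero f
  · refine (le_generateFrom fun U hU => ?_).trans
      (PrespectralSpace.isTopologicalBasis (X := X)).eq_generateFrom.ge
    refine isOpen_induced_iff.2 ⟨_, (PrimeSpectrum.basicOpen (coordinate hU.1 hU.2)).isOpen, ?_⟩
    ext x
    exact coordinate_ne_zero_iff hU.1 hU.2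

/-- A spectral space is homeomorphic to the prime spectrum of its ring of functions. -/
def homeomorphPrimeSpectrum (X : Type*) [TopologicalSpace X] [SpectralSpace X] :
    X ≃ₜ PrimeSpectrum (functionRing X) :=
  (Equiv.ofBijective toPrimeSpectrum ⟨isInducing_toPrimeSpectrum.injective,
    toPrimeSpectrum_surjective⟩).toHomeomorphOfIsInducing isInducing_toPrimeSpectrum

end Spectral

end Ring

end Hochster

end

/-- Hochster's characterization: a topological space is spectral (homeomorphic to the
Zariski spectrum of some commutative ring) iff it is sober, quasi-compact, and its
quasi-compact open subsets form a basis closed under finite intersections. -/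
theorem stmt10 (X : Type u) [TopologicalSpace X] :
    (∃ (R : Type u) (_ : CommRing R), Nonempty (X ≃ₜ PrimeSpectrum R)) ↔
      (QuasiSober X ∧ T0Space X ∧ CompactSpace X ∧
        (∀ U V : Set X, IsOpen U → IsCompact U → IsOpen V → IsCompact V →
          IsCompact (U ∩ V)) ∧
        TopologicalSpace.IsTopologicalBasis {U : Set X | IsOpen U ∧ IsCompact U}) := by
  constructor
  · rintro ⟨R, _, ⟨e⟩⟩
    have : CompactSpace X := e.symm.compactSpace
    have := e.isOpenEmbedding.spectralSpace
    exact ⟨inferInstance, inferInstance, inferInstance, QuasiSeparatedSpace.inter_isCompact,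
      PrespectralSpace.isTopologicalBasis⟩
  · rintro ⟨_, _, _, hinter, hbasis⟩
    have : QuasiSeparatedSpace X := ⟨hinter⟩
    have : PrespectralSpace X := ⟨hbasis⟩
    have : SpectralSpace X := {}
    exact ⟨Hochster.functionRing X, inferInstance, ⟨Hochster.homeomorphPrimeSpectrum X⟩⟩
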